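/- arXiv:1808.07673 — 2 statements merged into one kernel-verified Lean document; each statement's English description precedes it below -/
import Mathlib

section
/- Let Ω = [a,b] × [c,d] be a rectangle in ℝ², let Φ, ψ, φ : ℝ² → ℝ be Lipschitz continuous, and let k : ℝ → ℝ be Lipschitz continuous and even. Then ∫_Ω [ (1/π) ∫_{[a,b]} cos(Φ(x',y) − Φ(x,y)) · k(x'−x) · (ψ(x',y) − ψ(x,y)) / (x'−x) dx' ] · φ(x,y) d(x,y) = ∫_Ω ψ(x,y) · [ −(1/π) lim_{ε→0⁺} ∫_{[a,b] \ (x−ε,x+ε)} cos(Φ(x',y) − Φ(x,y)) · k(x'−x) · (φ(x',y) + φ(x,y)) / (x'−x) dx' ] d(x,y), where the inner limit exists for every (x,y) with x ∈ (a,b). -/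
open MeasureTheory Real Filter Set

/-- The singular integral `∫ g(t) / (t - x) dt` over `[a, b]` with the interval
`(x - ε, x + ε)` removed. -/
noncomputable def truncatedHilbert (a b : ℝ) (g : ℝ → ℝ) (x ε : ℝ) : ℝ :=
  ∫ t in Icc a b \ Ioo (x - ε) (x + ε), g t / (t - x)

/-- The principal value of `∫ g(t) / (t - x) dt` over `[a, b]`, with the singularity
subtracted. -/
noncomputable def pvHilbert (a b : ℝ) (g : ℝ → ℝ) (x : ℝ) : ℝ :=
  (∫ t in Icc a b, (g t - g x) / (t - x)) + g x * (log (b - x) - log (x - a))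

lemma sub_ne_zero_of_notMem_Ioo {x ε t : ℝ} (hε : 0 < ε) (ht : t ∉ Ioo (x - ε) (x + ε)) :
    t - x ≠ 0 := by
  rintro h
  exact ht ⟨by linarith, by linarith⟩

lemma isCompact_Icc_diff_Ioo (a b u v : ℝ) : IsCompact (Icc a b \ Ioo u v) :=
  isCompact_Icc.diff isOpen_Ioo

lemma integrableOn_div_sub {a b x ε : ℝ} {g : ℝ → ℝ} (hε : 0 < ε)
    (hg : ContinuousOn g (Icc a b)) :
    IntegrableOn (fun t => g t / (t - x)) (Icc a b \ Ioo (x - ε) (x + ε)) := by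
  refine ContinuousOn.integrableOn_compact (isCompact_Icc_diff_Ioo _ _ _ _) ?_
  exact (hg.mono sdiff_subset).div (by fun_prop)
    fun t ht => sub_ne_zero_of_notMem_Ioo hε ht.2

lemma setIntegral_Icc_inv_sub_right {b x ε : ℝ} (hε : 0 < ε) :
    ∫ t in Icc (x + ε) b, 1 / (t - x) = log (max (b - x) ε) - log ε := by
  rcases le_total (x + ε) b with h | h
  · rw [integral_Icc_eq_integral_Ioc, ← intervalIntegral.integral_of_le h,
      intervalIntegral.integral_comp_sub_right (fun t => 1 / t) x, add_sub_cancel_left,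
      integral_one_div_of_pos hε (by linarith), max_eq_left (by linarith),
      log_div (by linarith) hε.ne']
  · rw [max_eq_right (by linarith), sub_self, integral_Icc_eq_integral_Ioc,
      Ioc_eq_empty (by linarith), setIntegral_empty]

lemma setIntegral_Icc_inv_sub_left {a x ε : ℝ} (hε : 0 < ε) :
    ∫ t in Icc a (x - ε), 1 / (t - x) = log ε - log (max (x - a) ε) := by
  rcases le_total a (x - ε) with h | h
  · rw [integral_Icc_eq_integral_Ioc, ← intervalIntegral.integral_of_le h,
      intervalIntegral.integral_comp_sub_right (fun t => 1 / t) x,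
      integral_one_div_of_neg (by linarith) (by linarith), max_eq_left (by linarith),
      ← log_div hε.ne' (by linarith)]
    congr 1
    rw [← neg_div_neg_eq]
    congr 1 <;> ring
  · rw [max_eq_right (by linarith), sub_self, integral_Icc_eq_integral_Ioc,
      Ioc_eq_empty (by linarith), setIntegral_empty]

lemma truncatedHilbert_one {a b x ε : ℝ} (hx : x ∈ Ioo a b) (hε : 0 < ε) :
    truncatedHilbert a b (fun _ => 1) x ε = log (max (b - x) ε) - log (max (x - a) ε) := by
  have hset : Icc a b \ Ioo (x - ε) (x + ε) = Icc a (x - ε) ∪ Icc (x + ε) b := by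
    obtain ⟨h1, h2⟩ := hx
    ext t
    simp only [Set.mem_sdiff, mem_Icc, mem_Ioo, mem_union]
    grind
  have hint := integrableOn_div_sub (a := a) (b := b) (x := x) (g := fun _ => (1 : ℝ)) hε
    continuousOn_const
  rw [hset] at hint
  have hdisj : Disjoint (Icc a (x - ε)) (Icc (x + ε) b) := by
    rw [Set.disjoint_left]
    rintro t ⟨_, h1⟩ ⟨h2, _⟩
    linarith
  rw [truncatedHilbert, hset, setIntegral_union hdisj measurableSet_Icc hint.left_of_union
    hint.right_of_union, setIntegral_Icc_inv_sub_left hε, setIntegral_Icc_inv_sub_right hε]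
  ring

lemma truncatedHilbert_eq {a b x ε : ℝ} {g : ℝ → ℝ} (hx : x ∈ Ioo a b) (hε : 0 < ε)
    (hg : ContinuousOn g (Icc a b)) :
    truncatedHilbert a b g x ε =
      (∫ t in Icc a b \ Ioo (x - ε) (x + ε), (g t - g x) / (t - x)) +
        g x * (log (max (b - x) ε) - log (max (x - a) ε)) := by
  rw [← truncatedHilbert_one hx hε, truncatedHilbert, truncatedHilbert, ← integral_const_mul,
    ← integral_add (integrableOn_div_sub (g := fun t => g t - g x) hε (hg.sub continuousOn_const))
      ((integrableOn_div_sub hε continuousOn_const).const_mul _)]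
  congr 1
  ext t
  ring

lemma norm_div_sub_le {s : Set ℝ} {g : ℝ → ℝ} {L : NNReal} {x t : ℝ}
    (hg : LipschitzOnWith L g s) (hx : x ∈ s) (ht : t ∈ s) :
    ‖(g t - g x) / (t - x)‖ ≤ L := by
  rw [norm_div]
  refine div_le_of_le_mul₀ (norm_nonneg _) L.2 ?_
  simpa [Real.norm_eq_abs, Real.dist_eq] using hg.dist_le_mul t ht x hx

lemma tendsto_truncatedHilbert {a b x : ℝ} {g : ℝ → ℝ} {L : NNReal} (hx : x ∈ Ioo a b)
    (hg : LipschitzOnWith L g (Icc a b)) :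
    Tendsto (truncatedHilbert a b g x) (nhdsWithin 0 (Ioi 0)) (nhds (pvHilbert a b g x)) := by
  have hxI := Ioo_subset_Icc_self hx
  have hmeas : ∀ ε : ℝ, MeasurableSet (Ioo (x - ε) (x + ε))ᶜ := fun ε => measurableSet_Ioo.compl
  have hmax : ∀ u : ℝ, 0 < u → Tendsto (fun ε => log (max u ε)) (nhdsWithin 0 (Ioi 0))
      (nhds (log u)) := by
    intro u hu
    refine tendsto_const_nhds.congr' ?_
    filter_upwards [nhdsWithin_le_nhds (Iio_mem_nhds hu)] with ε hε
    rw [max_eq_left (le_of_lt hε)]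
  have hmain : Tendsto (fun ε => ∫ t in Icc a b, (Ioo (x - ε) (x + ε))ᶜ.indicator
      (fun t => (g t - g x) / (t - x)) t) (nhdsWithin 0 (Ioi 0))
      (nhds (∫ t in Icc a b, (g t - g x) / (t - x))) := by
    have hsm : AEStronglyMeasurable (fun t => (g t - g x) / (t - x))
        (volume.restrict (Icc a b)) := by
      refine AEMeasurable.aestronglyMeasurable ?_
      exact ((hg.continuousOn.aemeasurable measurableSet_Icc).sub_const _).div (by fun_prop)
    refine tendsto_integral_filter_of_dominated_convergence (fun _ => (L : ℝ))
      (Eventually.of_forall fun ε => hsm.indicator (hmeas ε)) (Eventually.of_forall fun ε => ?_)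
      (integrable_const _) ?_
    · refine (ae_restrict_iff' measurableSet_Icc).2 (Eventually.of_forall fun t ht => ?_)
      exact (norm_indicator_le_norm_self _ _).trans (norm_div_sub_le hg hxI ht)
    · filter_upwards [ae_restrict_of_ae (Measure.ae_ne volume x)] with t ht
      refine tendsto_const_nhds.congr' ?_
      have : 0 < |t - x| := abs_pos.2 (sub_ne_zero.2 ht)
      filter_upwards [nhdsWithin_le_nhds (Iio_mem_nhds this)] with ε hε
      rw [indicator_of_mem]
      rintro ⟨h1, h2⟩
      exact absurd (abs_lt.2 ⟨by linarith, by linarith⟩ : |t - x| < ε) (not_lt.2 (le_of_lt hε))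
  refine (hmain.add (((hmax _ (sub_pos.2 hx.2)).sub (hmax _ (sub_pos.2 hx.1))).const_mul
    (g x))).congr' ?_
  filter_upwards [self_mem_nhdsWithin] with ε hε
  rw [truncatedHilbert_eq hx hε hg.continuousOn, setIntegral_indicator (hmeas ε), sdiff_eq]

lemma abs_log_max_le {u ε : ℝ} (hu : 0 < u) (hε : 0 < ε) (hε1 : ε ≤ 1) :
    |log (max u ε)| ≤ |log u| := by
  rcases le_total ε u with h | h
  · rw [max_eq_left h]
  · rw [max_eq_right h, abs_of_nonpos (log_nonpos hε.le hε1),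
      abs_of_nonpos (log_nonpos hu.le (h.trans hε1))]
    linarith [log_le_log hu h]

lemma abs_truncatedHilbert_le {a b x ε M : ℝ} {g : ℝ → ℝ} {L : NNReal} (hx : x ∈ Ioo a b)
    (hε : 0 < ε) (hε1 : ε ≤ 1) (hg : LipschitzOnWith L g (Icc a b)) (hM : |g x| ≤ M) :
    |truncatedHilbert a b g x ε| ≤ L * (b - a) + M * (|log (b - x)| + |log (x - a)|) := by
  have hab : a ≤ b := (hx.1.trans hx.2).le
  have hxI := Ioo_subset_Icc_self hx
  rw [truncatedHilbert_eq hx hε hg.continuousOn]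
  refine (abs_add_le _ _).trans (add_le_add ?_ ?_)
  · have h := norm_setIntegral_le_of_norm_le_const (μ := volume)
      (isCompact_Icc_diff_Ioo a b (x - ε) (x + ε)).measure_lt_top
      (fun t ht => norm_div_sub_le hg hxI ht.1)
    refine h.trans (mul_le_mul_of_nonneg_left ?_ L.2)
    refine (measureReal_mono sdiff_subset isCompact_Icc.measure_lt_top.ne).trans ?_
    rw [Real.volume_real_Icc_of_le hab]
  · rw [abs_mul]
    refine mul_le_mul hM ((abs_sub _ _).trans (add_le_add ?_ ?_)) (abs_nonneg _)
      ((abs_nonneg _).trans hM)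
    · exact abs_log_max_le (sub_pos.2 hx.2) hε hε1
    · exact abs_log_max_le (sub_pos.2 hx.1) hε hε1

lemma pvHilbert_const_mul (a b r x : ℝ) (g : ℝ → ℝ) :
    pvHilbert a b (fun t => r * g t) x = r * pvHilbert a b g x := by
  simp only [pvHilbert, mul_add, ← integral_const_mul, ← mul_sub, mul_div_assoc, mul_assoc]

lemma LocallyLipschitz.mul_real {α : Type*} [PseudoEMetricSpace α] {f g : α → ℝ}
    (hf : LocallyLipschitz f) (hg : LocallyLipschitz g) :
    LocallyLipschitz fun x => f x * g x := by
  have h : LocallyLipschitz fun q : ℝ × ℝ => q.1 * q.2 :=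
    ContDiff.locallyLipschitz (𝕂 := ℝ) (by fun_prop)
  exact h.comp (hf.prodMk hg)

lemma truncatedHilbert_eq_indicator (a b x ε : ℝ) (g : ℝ → ℝ) :
    truncatedHilbert a b g x ε =
      ∫ t in Icc a b, if ε ≤ |t - x| then g t / (t - x) else 0 := by
  have hset : Icc a b \ Ioo (x - ε) (x + ε) = Icc a b ∩ {t | ε ≤ |t - x|} := by
    ext t
    simp only [Set.mem_sdiff, mem_Ioo, mem_inter_iff, mem_ofPred_eq, and_congr_right_iff, ← not_lt,
      abs_lt]
    intro _
    rw [sub_lt_iff_lt_add, neg_lt_sub_iff_lt_add]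
    grind
  have hm : MeasurableSet {t : ℝ | ε ≤ |t - x|} :=
    measurableSet_le measurable_const (by fun_prop)
  rw [truncatedHilbert, hset, ← setIntegral_indicator hm]
  rfl

lemma stronglyMeasurable_truncatedHilbert {G : ℝ × ℝ → ℝ → ℝ}
    (hG : Continuous (Function.uncurry G)) (a b ε : ℝ) :
    StronglyMeasurable fun p : ℝ × ℝ => truncatedHilbert a b (G p) p.1 ε := by
  simp only [truncatedHilbert_eq_indicator]
  have hm : MeasurableSet {q : (ℝ × ℝ) × ℝ | ε ≤ |q.2 - q.1.1|} :=
    measurableSet_le measurable_const (by fun_prop)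
  have : Measurable fun q : (ℝ × ℝ) × ℝ =>
      if ε ≤ |q.2 - q.1.1| then G q.1 q.2 / (q.2 - q.1.1) else 0 :=
    Measurable.ite hm (hG.measurable.div (by fun_prop)) measurable_const
  exact this.stronglyMeasurable.integral_prod_right'

lemma ae_fst_mem_Ioo (a b : ℝ) (T : Set ℝ) :
    ∀ᵐ p ∂(volume.restrict (Icc a b ×ˢ T) : Measure (ℝ × ℝ)), p.1 ∈ Ioo a b := by
  rw [Measure.volume_eq_prod, ← Measure.prod_restrict, ← restrict_Ioo_eq_restrict_Icc]
  exact Measure.quasiMeasurePreserving_fst.ae (ae_restrict_mem measurableSet_Ioo)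

lemma integrableOn_log_bound (a b c d C M : ℝ) (hab : a ≤ b) :
    IntegrableOn (fun p : ℝ × ℝ => C + M * (|log (b - p.1)| + |log (p.1 - a)|))
      (Icc a b ×ˢ Icc c d) := by
  have hlog : IntervalIntegrable log volume 0 (b - a) := intervalIntegral.intervalIntegrable_log'
  have h1 : IntegrableOn (fun x => log (x - a)) (Icc a b) := by
    have := hlog.comp_sub_right a
    rw [zero_add, sub_add_cancel, intervalIntegrable_iff_integrableOn_Icc_of_le hab] at this
    exact this
  have h2 : IntegrableOn (fun x => log (b - x)) (Icc a b) := by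
    have := (hlog.comp_sub_left b).symm
    rw [sub_zero, sub_sub_cancel, intervalIntegrable_iff_integrableOn_Icc_of_le hab] at this
    exact this
  have h3 : Integrable (fun x => C + M * (|log (b - x)| + |log (x - a)|))
      (volume.restrict (Icc a b)) :=
    (integrable_const C).add ((h2.abs.add h1.abs).const_mul M)
  rw [IntegrableOn, Measure.volume_eq_prod, ← Measure.prod_restrict]
  exact h3.comp_fst _

lemma exists_lipschitz_bound {G : ℝ × ℝ → ℝ → ℝ} (hG : LocallyLipschitz (Function.uncurry G))
    (a b c d : ℝ) :
    ∃ (L : NNReal) (M : ℝ), ∀ p ∈ Icc a b ×ˢ Icc c d, LipschitzOnWith L (G p) (Icc a b) ∧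
      ∀ t ∈ Icc a b, |G p t| ≤ M := by
  have hK : IsCompact ((Icc a b ×ˢ Icc c d) ×ˢ Icc a b) :=
    (isCompact_Icc.prod isCompact_Icc).prod isCompact_Icc
  obtain ⟨L, hL⟩ := (hG.locallyLipschitzOn (s := _)).exists_lipschitzOnWith_of_compact hK
  obtain ⟨M, hM⟩ := hK.exists_bound_of_continuousOn hG.continuous.continuousOn
  refine ⟨L, M, fun p hp => ⟨?_, fun t ht => hM (p, t) ⟨hp, ht⟩⟩⟩
  intro s hs t ht
  simpa [Prod.edist_eq] using hL (x := (p, s)) ⟨hp, hs⟩ (y := (p, t)) ⟨hp, ht⟩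

lemma ae_abs_truncatedHilbert_le {a b c d : ℝ} {G : ℝ × ℝ → ℝ → ℝ}
    (hG : LocallyLipschitz (Function.uncurry G)) :
    ∃ C M : ℝ, ∀ ε ∈ Ioc (0 : ℝ) 1, ∀ᵐ p ∂(volume.restrict (Icc a b ×ˢ Icc c d)),
      ‖truncatedHilbert a b (G p) p.1 ε‖ ≤ C + M * (|log (b - p.1)| + |log (p.1 - a)|) := by
  obtain ⟨L, M, h⟩ := exists_lipschitz_bound hG a b c d
  refine ⟨L * (b - a), M, fun ε hε => ?_⟩
  filter_upwards [ae_fst_mem_Ioo a b (Icc c d),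
    ae_restrict_mem (measurableSet_Icc.prod measurableSet_Icc)] with p hp hpΩ
  exact abs_truncatedHilbert_le hp hε.1 hε.2 (h p hpΩ).1 ((h p hpΩ).2 _ hpΩ.1)

lemma integrableOn_truncatedHilbert {a b c d ε : ℝ} {G : ℝ × ℝ → ℝ → ℝ} (hab : a ≤ b)
    (hG : LocallyLipschitz (Function.uncurry G)) (hε : ε ∈ Ioc (0 : ℝ) 1) :
    IntegrableOn (fun p : ℝ × ℝ => truncatedHilbert a b (G p) p.1 ε) (Icc a b ×ˢ Icc c d) := by
  obtain ⟨C, M, h⟩ := ae_abs_truncatedHilbert_le (a := a) (b := b) (c := c) (d := d) hG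
  exact (integrableOn_log_bound a b c d C M hab).mono'
    (stronglyMeasurable_truncatedHilbert hG.continuous a b ε).aestronglyMeasurable (h ε hε)

lemma tendsto_setIntegral_truncatedHilbert {a b c d : ℝ} {G : ℝ × ℝ → ℝ → ℝ} (hab : a ≤ b)
    (hG : LocallyLipschitz (Function.uncurry G)) :
    Tendsto (fun ε => ∫ p in Icc a b ×ˢ Icc c d, truncatedHilbert a b (G p) p.1 ε)
      (nhdsWithin 0 (Ioi 0)) (nhds (∫ p in Icc a b ×ˢ Icc c d, pvHilbert a b (G p) p.1)) := by
  obtain ⟨C, M, h⟩ := ae_abs_truncatedHilbert_le (a := a) (b := b) (c := c) (d := d) hG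
  obtain ⟨L, _, hL⟩ := exists_lipschitz_bound hG a b c d
  refine tendsto_integral_filter_of_dominated_convergence _ (Eventually.of_forall fun ε =>
    (stronglyMeasurable_truncatedHilbert hG.continuous a b ε).aestronglyMeasurable) ?_
    (integrableOn_log_bound a b c d C M hab) ?_
  · filter_upwards [Ioc_mem_nhdsGT one_pos] with ε hε using h ε hε
  · filter_upwards [ae_fst_mem_Ioo a b (Icc c d),
      ae_restrict_mem (measurableSet_Icc.prod measurableSet_Icc)] with p hp hpΩ
    exact tendsto_truncatedHilbert hp (hL p hpΩ).1

lemma integral_truncatedHilbert_eq_zero {a b ε : ℝ} {K : ℝ → ℝ → ℝ} (hε : 0 < ε)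
    (hK : Continuous (Function.uncurry K)) (hsymm : ∀ x t, K x t = K t x) :
    ∫ x in Icc a b, truncatedHilbert a b (K x) x ε = 0 := by
  simp only [truncatedHilbert_eq_indicator]
  set F : ℝ → ℝ → ℝ := fun x t => if ε ≤ |t - x| then K x t / (t - x) else 0 with hF
  have hanti : ∀ x t, F x t = -F t x := by
    intro x t
    simp only [hF, abs_sub_comm t x, hsymm x t]
    split_ifs
    · rw [← div_neg, neg_sub]
    · simp
  have hint : Integrable (Function.uncurry F)
      ((volume.restrict (Icc a b)).prod (volume.restrict (Icc a b))) := by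
    have hm : MeasurableSet {q : ℝ × ℝ | ε ≤ |q.2 - q.1|} :=
      measurableSet_le measurable_const (by fun_prop)
    have hmeas : Measurable (Function.uncurry F) :=
      Measurable.ite hm (hK.measurable.div (by fun_prop)) measurable_const
    have hΩ : IsCompact (Icc a b ×ˢ Icc a b) := isCompact_Icc.prod isCompact_Icc
    obtain ⟨M, hM⟩ := hΩ.exists_bound_of_continuousOn hK.continuousOn
    rw [Measure.prod_restrict]
    refine IntegrableOn.of_bound (by
      rw [← Measure.volume_eq_prod]; exact hΩ.measure_lt_top)
      hmeas.aestronglyMeasurable (M / ε) ?_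
    refine (ae_restrict_iff' (measurableSet_Icc.prod measurableSet_Icc)).2
      (Eventually.of_forall fun q hq => ?_)
    have hMq := hM q hq
    have hM0 : 0 ≤ M := (norm_nonneg _).trans hMq
    simp only [hF, Function.uncurry]
    split_ifs with h
    · rw [norm_div]
      exact div_le_div₀ hM0 hMq hε h
    · rw [norm_zero]
      positivity
  have hswap := integral_integral_swap hint
  have hneg : ∫ t in Icc a b, ∫ x in Icc a b, F x t = -∫ t in Icc a b, ∫ x in Icc a b, F t x := by
    rw [← integral_neg]
    congr 1 with t
    rw [← integral_neg]
    congr 1 with x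
    exact hanti x t
  linarith

lemma setIntegral_truncatedHilbert_eq_zero {a b c d ε : ℝ} {G : ℝ × ℝ → ℝ → ℝ} (hab : a ≤ b)
    (hG : LocallyLipschitz (Function.uncurry G)) (hε : ε ∈ Ioc (0 : ℝ) 1)
    (hsymm : ∀ x t y, G (x, y) t = G (t, y) x) :
    ∫ p in Icc a b ×ˢ Icc c d, truncatedHilbert a b (G p) p.1 ε = 0 := by
  have hint := integrableOn_truncatedHilbert (c := c) (d := d) hab hG hε
  rw [IntegrableOn, Measure.volume_eq_prod, ← Measure.prod_restrict] at hint
  rw [Measure.volume_eq_prod, ← Measure.prod_restrict, integral_prod_symm _ hint]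
  refine (integral_congr_ae (Eventually.of_forall fun y => ?_)).trans (integral_zero _ _)
  have hc : Continuous (Function.uncurry fun x t => G (x, y) t) :=
    hG.continuous.comp (f := fun q : ℝ × ℝ => ((q.1, y), q.2)) (by fun_prop)
  exact integral_truncatedHilbert_eq_zero hε.1 hc fun x t => hsymm x t y

lemma truncatedHilbert_add {a b x ε : ℝ} {g h : ℝ → ℝ} (hε : 0 < ε) (hg : Continuous g)
    (hh : Continuous h) :
    truncatedHilbert a b g x ε + truncatedHilbert a b h x ε =
      truncatedHilbert a b (fun t => g t + h t) x ε := by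
  simp only [truncatedHilbert, add_div]
  exact (integral_add (integrableOn_div_sub hε hg.continuousOn)
    (integrableOn_div_sub hε hh.continuousOn)).symm

/-- If `G + H` is symmetric in the integration variable and the first coordinate, then the
integrals of the principal values associated with `G` and `H` cancel. -/
lemma setIntegral_pvHilbert_add_eq_zero {a b c d : ℝ} {G H : ℝ × ℝ → ℝ → ℝ} (hab : a ≤ b)
    (hG : LocallyLipschitz (Function.uncurry G)) (hH : LocallyLipschitz (Function.uncurry H))
    (hsymm : ∀ x t y, G (x, y) t + H (x, y) t = G (t, y) x + H (t, y) x) :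
    (∫ p in Icc a b ×ˢ Icc c d, pvHilbert a b (G p) p.1) +
      ∫ p in Icc a b ×ˢ Icc c d, pvHilbert a b (H p) p.1 = 0 := by
  refine tendsto_nhds_unique ((tendsto_setIntegral_truncatedHilbert hab hG).add
    (tendsto_setIntegral_truncatedHilbert hab hH)) (tendsto_const_nhds.congr' ?_)
  filter_upwards [Ioc_mem_nhdsGT one_pos] with ε hε
  rw [← integral_add (integrableOn_truncatedHilbert hab hG hε)
    (integrableOn_truncatedHilbert hab hH hε)]
  have hcont : ∀ {F : ℝ × ℝ → ℝ → ℝ}, LocallyLipschitz (Function.uncurry F) → ∀ p,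
      Continuous (F p) := fun hF p => hF.continuous.comp (Continuous.prodMk_right p)
  simp only [truncatedHilbert_add hε.1 (hcont hG _) (hcont hH _)]
  exact (setIntegral_truncatedHilbert_eq_zero (G := fun p t => G p t + H p t) hab (hG.add hH) hε
    hsymm).symm

/-- Adjoint of the Fréchet derivative of the roof wavefront sensor operator in
`x`-direction with respect to the `L²(Ω)` inner product on a rectangle
`Ω = [a,b] × [c,d]`: the pairing of `R_x'(Φ)ψ` against `φ` equals the pairing of `ψ`
against `−(1/π)` times the principal-value integral; the inner limit exists for every
point with first coordinate in `(a,b)`. -/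
theorem stmt_4 (a b c d : ℝ) (hab : a < b) (hcd : c < d)
    (Φ ψ φ : ℝ × ℝ → ℝ) (k : ℝ → ℝ) (LΦ Lψ Lφ Lk : NNReal)
    (hΦ : LipschitzWith LΦ Φ) (hψ : LipschitzWith Lψ ψ) (hφ : LipschitzWith Lφ φ)
    (hk : LipschitzWith Lk k) (hke : ∀ u, k (-u) = k u) :
    ∃ pv : ℝ × ℝ → ℝ,
      (∀ p : ℝ × ℝ, p.1 ∈ Set.Ioo a b → Filter.Tendsto
        (fun ε : ℝ => -(1 / Real.pi) * ∫ x' in Set.Icc a b \ Set.Ioo (p.1 - ε) (p.1 + ε),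
          Real.cos (Φ (x', p.2) - Φ p) * k (x' - p.1) * (φ (x', p.2) + φ p) / (x' - p.1))
        (nhdsWithin 0 (Set.Ioi 0)) (nhds (pv p))) ∧
      (∫ p in Set.Icc a b ×ˢ Set.Icc c d,
          ((1 / Real.pi) * ∫ x' in Set.Icc a b,
            Real.cos (Φ (x', p.2) - Φ p) * k (x' - p.1) * (ψ (x', p.2) - ψ p) / (x' - p.1))
            * φ p)
        = ∫ p in Set.Icc a b ×ˢ Set.Icc c d, ψ p * pv p := by
  have hpt : LocallyLipschitz fun q : (ℝ × ℝ) × ℝ => (q.2, q.1.2) :=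
    (LipschitzWith.prod_snd.prodMk
      (LipschitzWith.prod_snd.comp LipschitzWith.prod_fst)).locallyLipschitz
  have hfst : LocallyLipschitz fun q : (ℝ × ℝ) × ℝ => q.1 :=
    LipschitzWith.prod_fst.locallyLipschitz
  have hker : LocallyLipschitz fun q : (ℝ × ℝ) × ℝ =>
      Real.cos (Φ (q.2, q.1.2) - Φ q.1) * k (q.2 - q.1.1) := by
    have hcos : LocallyLipschitz Real.cos :=
      ContDiff.locallyLipschitz (𝕂 := ℝ) Real.contDiff_cos
    have hsub : LocallyLipschitz fun q : (ℝ × ℝ) × ℝ => q.2 - q.1.1 :=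
      (LipschitzWith.prod_snd.sub
        (LipschitzWith.prod_fst.comp LipschitzWith.prod_fst)).locallyLipschitz
    exact (hcos.comp ((hΦ.locallyLipschitz.comp hpt).sub
      (hΦ.locallyLipschitz.comp hfst))).mul_real (hk.locallyLipschitz.comp hsub)
  set A : ℝ × ℝ → ℝ → ℝ := fun p t =>
    Real.cos (Φ (t, p.2) - Φ p) * k (t - p.1) * (φ (t, p.2) + φ p) with hA
  set B : ℝ × ℝ → ℝ → ℝ := fun p t =>
    φ p * (Real.cos (Φ (t, p.2) - Φ p) * k (t - p.1) * (ψ (t, p.2) - ψ p)) with hB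
  have hAl : LocallyLipschitz (Function.uncurry A) :=
    hker.mul_real ((hφ.locallyLipschitz.comp hpt).add (hφ.locallyLipschitz.comp hfst))
  have hBl : LocallyLipschitz (Function.uncurry B) :=
    (hφ.locallyLipschitz.comp hfst).mul_real
      (hker.mul_real ((hψ.locallyLipschitz.comp hpt).sub (hψ.locallyLipschitz.comp hfst)))
  have hψA : LocallyLipschitz (Function.uncurry fun p t => ψ p * A p t) :=
    (hψ.locallyLipschitz.comp hfst).mul_real hAl
  refine ⟨fun p => -(1 / Real.pi) * pvHilbert a b (A p) p.1, fun p hp => ?_, ?_⟩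
  · obtain ⟨L, _, hL⟩ := exists_lipschitz_bound hAl a b p.2 p.2
    have hpΩ : p ∈ Icc a b ×ˢ Icc p.2 p.2 := ⟨Ioo_subset_Icc_self hp, le_rfl, le_rfl⟩
    exact (tendsto_truncatedHilbert hp (hL p hpΩ).1).const_mul _
  · have hsymm : ∀ x t y, B (x, y) t + ψ (x, y) * A (x, y) t =
        B (t, y) x + ψ (t, y) * A (t, y) x := by
      intro x t y
      simp only [hA, hB]
      rw [← Real.cos_neg, neg_sub, ← hke, neg_sub]
      ring
    have hzero := setIntegral_pvHilbert_add_eq_zero (c := c) (d := d) hab.le hBl hψA hsymm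
    have hleft : ∀ p : ℝ × ℝ, (1 / Real.pi * ∫ x' in Set.Icc a b,
        Real.cos (Φ (x', p.2) - Φ p) * k (x' - p.1) * (ψ (x', p.2) - ψ p) / (x' - p.1)) * φ p =
        1 / Real.pi * pvHilbert a b (B p) p.1 := by
      intro p
      simp only [hB, pvHilbert_const_mul]
      simp only [pvHilbert, sub_self, mul_zero, sub_zero, zero_mul, add_zero]
      ring
    have hright : ∀ p : ℝ × ℝ, ψ p * (-(1 / Real.pi) * pvHilbert a b (A p) p.1) =
        -(1 / Real.pi) * pvHilbert a b (fun t => ψ p * A p t) p.1 := by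
      intro p
      rw [pvHilbert_const_mul]
      ring
    simp only [hleft, hright, integral_const_mul]
    rw [eq_neg_of_add_eq_zero_left hzero]
    ring
end

section
/- Let X and Y be real Hilbert spaces, Φ₀ ∈ X, ρ > 0, 0 ≤ η < 1/2, and let P : X → Y be Fréchet differentiable at every point of the closed ball B = {Φ : ‖Φ − Φ₀‖ ≤ 2ρ}, with derivative P'(Φ) satisfying ‖P'(Φ)‖ ≤ 1 for all Φ ∈ B and the tangential cone condition ‖P(Φ) − P(Φ̃) − P'(Φ)(Φ − Φ̃)‖ ≤ η‖P(Φ) − P(Φ̃)‖ for all Φ, Φ̃ ∈ B. Let s ∈ Y and suppose there exists Φ_* with ‖Φ_* − Φ₀‖ ≤ ρ and P(Φ_*) = s. Define the Landweber iterates Φ_{k+1} = Φ_k + P'(Φ_k)*(s − P(Φ_k)) with Φ_0 = Φ₀. Then (Φ_k) converges in norm to some Φ̄ ∈ B with P(Φ̄) = s. -/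
open ContinuousLinearMap Filter

/-- One Landweber step does not increase the distance to a solution `z`, and the squared distance
drops by at least `(1 - 2 * η)` times the squared residual. -/
theorem landweber_step_norm_sq_le {X Y : Type*} [NormedAddCommGroup X] [InnerProductSpace ℝ X]
    [CompleteSpace X] [NormedAddCommGroup Y] [InnerProductSpace ℝ Y] [CompleteSpace Y]
    (A : X →L[ℝ] Y) (hA : ‖A‖ ≤ 1) {η : ℝ} {x z : X} {r : Y}
    (hr : ‖-r - A (x - z)‖ ≤ η * ‖r‖) :
    ‖x + adjoint A r - z‖ ^ 2 + (1 - 2 * η) * ‖r‖ ^ 2 ≤ ‖x - z‖ ^ 2 := by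
  have hexp : ‖x + adjoint A r - z‖ ^ 2
      = ‖x - z‖ ^ 2 + 2 * inner ℝ (A (x - z)) r + ‖adjoint A r‖ ^ 2 := by
    rw [add_sub_right_comm, norm_add_sq_real, adjoint_inner_right]
  have hadj : ‖adjoint A r‖ ≤ ‖r‖ := by
    refine (le_opNorm _ _).trans ?_
    rw [LinearIsometryEquiv.norm_map]
    exact mul_le_of_le_one_left (norm_nonneg _) hA
  have hadj_sq : ‖adjoint A r‖ ^ 2 ≤ ‖r‖ ^ 2 := by gcongr
  have hsplit : inner ℝ (-r - A (x - z)) r = -‖r‖ ^ 2 - inner ℝ (A (x - z)) r := by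
    rw [inner_sub_left, inner_neg_left, real_inner_self_eq_norm_sq]
  have hcs : -(η * ‖r‖ * ‖r‖) ≤ inner ℝ (-r - A (x - z)) r := by
    have h := (abs_le.mp (abs_real_inner_le_norm (-r - A (x - z)) r)).1
    have h' := mul_le_mul_of_nonneg_right hr (norm_nonneg r)
    linarith
  nlinarith

/-- If the increments of `u` paired with `v` are dominated by the decrements of `a`, then so are
the differences of `u`. -/
theorem abs_inner_sub_le_of_abs_inner_succ_sub_le {X : Type*} [NormedAddCommGroup X]
    [InnerProductSpace ℝ X] {u : ℕ → X} {a : ℕ → ℝ} {v : X} {m n : ℕ} (hmn : m ≤ n)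
    (h : ∀ i, m ≤ i → i < n → |inner ℝ (u (i + 1) - u i) v| ≤ a i - a (i + 1)) :
    |inner ℝ (u n - u m) v| ≤ a m - a n := by
  induction n, hmn using Nat.le_induction with
  | base => simp
  | succ n hmn ih =>
    have hn := h n hmn n.lt_succ_self
    have ih := ih fun i hi hin => h i hi (hin.trans n.lt_succ_self)
    have hsum : inner ℝ (u (n + 1) - u m) v
        = inner ℝ (u (n + 1) - u n) v + inner ℝ (u n - u m) v := by
      rw [← inner_add_left, sub_add_sub_cancel]
    rw [hsum]
    linarith [abs_add_le (inner ℝ (u (n + 1) - u n) v) (inner ℝ (u n - u m) v)]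

/-- A sequence in a metric space whose squared distances are dominated by the decrements of a
nonnegative sequence is Cauchy. -/
theorem cauchySeq_of_dist_sq_le_sub {X : Type*} [PseudoMetricSpace X] {u : ℕ → X} {a : ℕ → ℝ}
    (ha : ∀ n, 0 ≤ a n) (h : ∀ m n, m ≤ n → dist (u m) (u n) ^ 2 ≤ a m - a n) :
    CauchySeq u := by
  have hanti : Antitone a := fun m n hmn => by linarith [h m n hmn, sq_nonneg (dist (u m) (u n))]
  have hbdd : BddBelow (Set.range a) := ⟨0, by rintro _ ⟨n, rfl⟩; exact ha n⟩
  have hlim := tendsto_atTop_ciInf hanti hbdd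
  have hle : ∀ N m n, N ≤ m → m ≤ n → dist (u m) (u n) ≤ √(a N - ⨅ i, a i) := by
    intro N m n hNm hmn
    apply Real.le_sqrt_of_sq_le
    linarith [h m n hmn, hanti hNm, ciInf_le hbdd n]
  refine cauchySeq_of_le_tendsto_0 (fun N => √(a N - ⨅ i, a i)) (fun m n N hm hn => ?_) ?_
  · rcases le_total m n with hmn | hnm
    · exact hle N m n hm hmn
    · rw [dist_comm]
      exact hle N n m hn hnm
  · simpa using (hlim.sub_const (⨅ i, a i)).sqrt

/-- The tangential cone condition bounds the linearization by the increment of the operator. -/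
theorem norm_le_one_add_mul_of_norm_sub_le {Y : Type*} [SeminormedAddCommGroup Y] {y w : Y}
    {η : ℝ} (h : ‖y - w‖ ≤ η * ‖y‖) : ‖w‖ ≤ (1 + η) * ‖y‖ := by
  have := norm_sub_norm_le w y
  rw [norm_sub_rev] at this
  linarith

/-- Exact-data convergence of the non-linear Landweber iteration
(Hanke–Neubauer–Scherzer): under the scaling condition `‖P'(Φ)‖ ≤ 1` and the tangential
cone condition with constant `η < 1/2` on the ball `B_{2ρ}(Φ₀)`, if a solution exists in
`B_ρ(Φ₀)`, the Landweber iterates converge in norm to some solution of `P(Φ) = s`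
in the ball `B_{2ρ}(Φ₀)`. -/
theorem stmt_12 {X Y : Type*} [NormedAddCommGroup X] [InnerProductSpace ℝ X] [CompleteSpace X]
    [NormedAddCommGroup Y] [InnerProductSpace ℝ Y] [CompleteSpace Y]
    (P : X → Y) (P' : X → X →L[ℝ] Y) (Φ₀ : X) (ρ η : ℝ)
    (hρ : 0 < ρ) (hη0 : 0 ≤ η) (hη : η < 1 / 2)
    (hdiff : ∀ Φ, ‖Φ - Φ₀‖ ≤ 2 * ρ → HasFDerivAt P (P' Φ) Φ)
    (hscale : ∀ Φ, ‖Φ - Φ₀‖ ≤ 2 * ρ → ‖P' Φ‖ ≤ 1)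
    (hcone : ∀ Φ Φ', ‖Φ - Φ₀‖ ≤ 2 * ρ → ‖Φ' - Φ₀‖ ≤ 2 * ρ →
      ‖P Φ - P Φ' - P' Φ (Φ - Φ')‖ ≤ η * ‖P Φ - P Φ'‖)
    (s : Y) (Φstar : X) (hstar : ‖Φstar - Φ₀‖ ≤ ρ) (hsol : P Φstar = s)
    (Φ : ℕ → X) (hΦ0 : Φ 0 = Φ₀)
    (hiter : ∀ k, Φ (k + 1) = Φ k + ContinuousLinearMap.adjoint (P' (Φ k)) (s - P (Φ k))) :
    ∃ Φbar : X, ‖Φbar - Φ₀‖ ≤ 2 * ρ ∧ P Φbar = s ∧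
      Filter.Tendsto Φ Filter.atTop (nhds Φbar) := by
  have hc : 0 < 1 - 2 * η := by linarith
  have hstar_mem : ‖Φstar - Φ₀‖ ≤ 2 * ρ := by linarith
  have hstep : ∀ k, ‖Φ k - Φ₀‖ ≤ 2 * ρ →
      ‖Φ (k + 1) - Φstar‖ ^ 2 + (1 - 2 * η) * ‖s - P (Φ k)‖ ^ 2 ≤ ‖Φ k - Φstar‖ ^ 2 := by
    intro k hk
    rw [hiter k]
    refine landweber_step_norm_sq_le _ (hscale _ hk) ?_
    have h := hcone _ _ hk hstar_mem
    rwa [hsol, norm_sub_rev (P (Φ k)) s, ← neg_sub s] at h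
  have hball : ∀ x, ‖x - Φstar‖ ≤ ρ → ‖x - Φ₀‖ ≤ 2 * ρ := fun x hx => by
    linarith [norm_sub_le_norm_sub_add_norm_sub x Φstar Φ₀]
  have hdist : ∀ k, ‖Φ k - Φstar‖ ≤ ρ := by
    intro k
    induction k with
    | zero => rwa [hΦ0, norm_sub_rev]
    | succ k ih =>
      refine le_trans (le_of_sq_le_sq ?_ (norm_nonneg _)) ih
      have := hstep k (hball _ ih)
      nlinarith [sq_nonneg ‖s - P (Φ k)‖]
  have hmem : ∀ k, ‖Φ k - Φ₀‖ ≤ 2 * ρ := fun k => hball _ (hdist k)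
  set a : ℕ → ℝ := fun k => ‖Φ k - Φstar‖ ^ 2 with ha
  have hres : ∀ k, ‖s - P (Φ k)‖ ^ 2 ≤ (1 - 2 * η)⁻¹ * (a k - a (k + 1)) := by
    intro k
    rw [← div_eq_inv_mul, le_div_iff₀ hc]
    linarith [hstep k (hmem k)]
  have hanti : Antitone a := antitone_nat_of_succ_le fun k => by
    nlinarith [hstep k (hmem k), sq_nonneg ‖s - P (Φ k)‖]
  have hinner : ∀ i l, ‖s - P (Φ l)‖ ≤ ‖s - P (Φ i)‖ →
      |inner ℝ (Φ (i + 1) - Φ i) (Φ l - Φstar)| ≤ 3 * (1 + η) * ‖s - P (Φ i)‖ ^ 2 := by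
    intro i l hli
    have h₁ := norm_le_one_add_mul_of_norm_sub_le (hcone _ _ (hmem i) hstar_mem)
    have h₂ := norm_le_one_add_mul_of_norm_sub_le (hcone _ _ (hmem i) (hmem l))
    rw [hsol, norm_sub_rev (P (Φ i)) s] at h₁
    have h₃ : ‖P (Φ i) - P (Φ l)‖ ≤ 2 * ‖s - P (Φ i)‖ := by
      have := norm_sub_le (s - P (Φ l)) (s - P (Φ i))
      rw [sub_sub_sub_cancel_left] at this
      linarith
    have h₄ : ‖P' (Φ i) (Φ l - Φstar)‖ ≤ 3 * (1 + η) * ‖s - P (Φ i)‖ := by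
      have hsub : Φ l - Φstar = (Φ i - Φstar) - (Φ i - Φ l) := by abel
      rw [hsub, map_sub]
      have := norm_sub_le (P' (Φ i) (Φ i - Φstar)) (P' (Φ i) (Φ i - Φ l))
      nlinarith
    rw [hiter i, add_sub_cancel_left, adjoint_inner_left]
    refine (abs_real_inner_le_norm _ _).trans ?_
    nlinarith [mul_le_mul_of_nonneg_left h₄ (norm_nonneg (s - P (Φ i)))]
  set K : ℝ := 3 * (1 + η) * (1 - 2 * η)⁻¹ with hK
  have hK0 : 0 ≤ K := by positivity
  have htele : ∀ m n l, m ≤ n →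
      (∀ i, m ≤ i → i < n → ‖s - P (Φ l)‖ ≤ ‖s - P (Φ i)‖) →
      |inner ℝ (Φ n - Φ m) (Φ l - Φstar)| ≤ K * (a m - a n) := by
    intro m n l hmn hmin
    rw [mul_sub]
    refine abs_inner_sub_le_of_abs_inner_succ_sub_le (a := fun k => K * a k) hmn
      fun i hi hin => (hinner i l (hmin i hi hin)).trans ?_
    rw [← mul_sub, hK, mul_assoc _ (1 - 2 * η)⁻¹]
    exact mul_le_mul_of_nonneg_left (hres i) (by positivity)
  have hsq : ∀ i l, ‖Φ i - Φ l‖ ^ 2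
      = a i - a l - 2 * inner ℝ (Φ i - Φ l) (Φ l - Φstar) := by
    intro i l
    have h := norm_add_sq_real (Φ i - Φ l) (Φ l - Φstar)
    rw [sub_add_sub_cancel] at h
    simp only [ha]
    linarith
  have hcauchy : CauchySeq Φ := by
    refine cauchySeq_of_dist_sq_le_sub (a := fun k => (2 + 4 * K) * a k)
      (fun n => by positivity) fun j k hjk => ?_
    obtain ⟨l, hl, hmin⟩ := Finset.exists_min_image (Finset.Icc j k) (fun i => ‖s - P (Φ i)‖)
      ⟨j, Finset.left_mem_Icc.mpr hjk⟩
    simp only [Finset.mem_Icc] at hl hmin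
    have hjl := htele j l l hl.1 fun i hi hil => hmin i ⟨hi, hil.le.trans hl.2⟩
    have hlk := htele l k l hl.2 fun i hi hik => hmin i ⟨hl.1.trans hi, hik.le⟩
    rw [← neg_sub, inner_neg_left, abs_neg] at hjl
    have htri : dist (Φ j) (Φ k) ≤ ‖Φ j - Φ l‖ + ‖Φ k - Φ l‖ := by
      rw [dist_eq_norm, norm_sub_rev (Φ k)]
      exact norm_sub_le_norm_sub_add_norm_sub _ _ _
    have hdsq : dist (Φ j) (Φ k) ^ 2 ≤ 2 * (‖Φ j - Φ l‖ ^ 2 + ‖Φ k - Φ l‖ ^ 2) :=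
      (pow_le_pow_left₀ dist_nonneg htri 2).trans (add_sq_le)
    linarith [hsq j l, hsq k l, (abs_le.mp hjl).1, (abs_le.mp hlk).1, hanti hl.2]
  obtain ⟨Φbar, hlim⟩ := cauchySeq_tendsto_of_complete hcauchy
  have hbar : ‖Φbar - Φ₀‖ ≤ 2 * ρ :=
    le_of_tendsto (hlim.sub_const Φ₀).norm (Eventually.of_forall hmem)
  refine ⟨Φbar, hbar, ?_, hlim⟩
  have hPlim : Tendsto (fun k => s - P (Φ k)) atTop (nhds (s - P Φbar)) :=
    ((hdiff Φbar hbar).continuousAt.tendsto.comp hlim).const_sub s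
  have halim : Tendsto a atTop (nhds (‖Φbar - Φstar‖ ^ 2)) := (hlim.sub_const Φstar).norm.pow 2
  have hle : ‖s - P Φbar‖ ^ 2 ≤ 0 := by
    refine le_of_tendsto_of_tendsto' (hPlim.norm.pow 2) ?_ hres
    simpa using (halim.sub (halim.comp (tendsto_add_atTop_nat 1))).const_mul (1 - 2 * η)⁻¹
  have hzero : s - P Φbar = 0 := by
    simpa using le_antisymm hle (sq_nonneg _)
  exact (sub_eq_zero.mp hzero).symm
end
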